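/- arXiv:2408.07182 — 2 statements merged into one kernel-verified Lean document; each statement's English description precedes it below -/
import Mathlib

section
/- Let Φ : ℝ^d → ℝ ∪ {+∞} be proper, locally Lipschitz continuous on its domain, and bounded below, and let D : ℝ^d → Set(ℝ^d) be a conservative field for Φ. Let T > 0 and let x : [0,T] → ℝ^d be absolutely continuous with derivative u, such that x(t) ∈ dom D for all t ∈ [0,T] and u(t) ∈ −D(x(t)) for almost every t. Then ∫₀^T ‖u(t)‖² dt = Φ(x(0)) − Φ(x(T)), and consequently ∫₀^T ‖u(t)‖ dt ≤ √T · √(Φ(x(0)) − inf_{y∈ℝ^d} Φ(y)). -/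
open scoped RealInnerProductSpace
open MeasureTheory

noncomputable section

/-- Euclidean space ℝ^d. -/
abbrev Euc (d : ℕ) := EuclideanSpace ℝ (Fin d)

/-- Proper: somewhere finite and never −∞. -/
def ProperFn {d : ℕ} (Φ : Euc d → EReal) : Prop :=
  (∃ x, Φ x ≠ ⊤) ∧ ∀ x, Φ x ≠ ⊥

/-- Locally Lipschitz on the domain `{x | Φ x ≠ ⊤}`. -/
def LocLipOnDom {d : ℕ} (Φ : Euc d → EReal) : Prop :=
  ∀ x : Euc d, Φ x ≠ ⊤ → ∃ ε > (0:ℝ), ∃ K : ℝ, ∀ y : Euc d, Φ y ≠ ⊤ → ∀ z : Euc d, Φ z ≠ ⊤ →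
    ‖y - x‖ ≤ ε → ‖z - x‖ ≤ ε → |(Φ y).toReal - (Φ z).toReal| ≤ K * ‖y - z‖

/-- `D` is a conservative field for `Φ`: closed graph, `dom D ⊆ dom Φ`, and the
chain-rule property along absolutely continuous curves staying in `dom D`. -/
def IsConservativeField {d : ℕ} (D : Euc d → Set (Euc d)) (Φ : Euc d → EReal) : Prop :=
  IsClosed {p : Euc d × Euc d | p.2 ∈ D p.1} ∧
  (∀ x : Euc d, (D x).Nonempty → Φ x ≠ ⊤) ∧
  ∀ x u : ℝ → Euc d, IntervalIntegrable u volume 0 1 →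
    (∀ t ∈ Set.Icc (0:ℝ) 1, x t = x 0 + ∫ s in (0:ℝ)..t, u s) →
    (∀ t ∈ Set.Icc (0:ℝ) 1, (D (x t)).Nonempty) →
    ∀ᵐ t ∂volume, t ∈ Set.Ioo (0:ℝ) 1 →
      ∀ v ∈ D (x t), HasDerivAt (fun s => (Φ (x s)).toReal) (⟪v, u t⟫ : ℝ) t

open Set Filter Topology in
/-- A curve whose increments are dominated by those of an absolutely continuous function is
absolutely continuous. -/
theorem AbsolutelyContinuousOnInterval.of_dist_le {X Y : Type*} [PseudoMetricSpace X]
    [PseudoMetricSpace Y] {f : ℝ → X} {g : ℝ → Y} {a b K : ℝ}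
    (hg : AbsolutelyContinuousOnInterval g a b)
    (h : ∀ s ∈ uIcc a b, ∀ t ∈ uIcc a b, dist (f s) (f t) ≤ K * dist (g s) (g t)) :
    AbsolutelyContinuousOnInterval f a b := by
  refine squeeze_zero' (Eventually.of_forall fun E => Finset.sum_nonneg fun i _ => dist_nonneg) ?_
    (by simpa using Tendsto.const_mul K hg)
  filter_upwards [mem_inf_of_right (mem_principal_self _)] with E hE
  rw [Finset.mul_sum]
  exact Finset.sum_le_sum fun i hi => h _ (hE.1 i hi).1 _ (hE.1 i hi).2

/-- A locally Lipschitz function on its domain is Lipschitz on compact subsets of the domain. -/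
theorem LocLipOnDom.exists_lipschitzOnWith {d : ℕ} {Φ : Euc d → EReal} (hlip : LocLipOnDom Φ)
    {C : Set (Euc d)} (hC : IsCompact C) (hdom : ∀ y ∈ C, Φ y ≠ ⊤) :
    ∃ K, LipschitzOnWith K (fun y => (Φ y).toReal) C := by
  refine LocallyLipschitzOn.exists_lipschitzOnWith_of_compact hC fun y hy => ?_
  obtain ⟨ε, hε, K, hK⟩ := hlip y (hdom y hy)
  refine ⟨K.toNNReal, Metric.closedBall y ε ∩ C,
    Filter.inter_mem (mem_nhdsWithin_of_mem_nhds (Metric.closedBall_mem_nhds y hε))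
      self_mem_nhdsWithin, LipschitzOnWith.of_dist_le' fun z hz w hw => ?_⟩
  rw [Real.dist_eq, dist_eq_norm]
  exact hK z (hdom z hz.2) w (hdom w hw.2) (mem_closedBall_iff_norm.1 hz.1)
    (mem_closedBall_iff_norm.1 hw.1)

/-- Along an absolutely continuous curve in the domain, a locally Lipschitz function is absolutely
continuous. -/
theorem LocLipOnDom.absolutelyContinuousOnInterval_comp {d : ℕ} {Φ : Euc d → EReal}
    (hlip : LocLipOnDom Φ) {T : ℝ} (hT : 0 ≤ T) {x u : ℝ → Euc d}
    (hu : IntervalIntegrable u volume 0 T)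
    (hx : ∀ t ∈ Set.Icc (0:ℝ) T, x t = x 0 + ∫ s in (0:ℝ)..t, u s)
    (hdom : ∀ t ∈ Set.Icc (0:ℝ) T, Φ (x t) ≠ ⊤) :
    AbsolutelyContinuousOnInterval (fun t => (Φ (x t)).toReal) 0 T := by
  have hicc : Set.uIcc 0 T = Set.Icc 0 T := Set.uIcc_of_le hT
  have hint : ∀ s ∈ Set.Icc (0:ℝ) T, ∀ t ∈ Set.Icc (0:ℝ) T, IntervalIntegrable u volume s t :=
    fun s hs t ht => hu.mono_set (hicc ▸ Set.uIcc_subset_Icc hs ht)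
  have h0 : (0:ℝ) ∈ Set.Icc 0 T := ⟨le_rfl, hT⟩
  have hxac : AbsolutelyContinuousOnInterval x 0 T := by
    refine AbsolutelyContinuousOnInterval.of_dist_le (K := 1)
      (hu.norm.absolutelyContinuousOnInterval_intervalIntegral (c := 0) Set.left_mem_uIcc) ?_
    rw [hicc]
    intro s hs t ht
    rw [dist_eq_norm, Real.dist_eq, hx s hs, hx t ht, add_sub_add_left_eq_sub,
      intervalIntegral.integral_interval_sub_left (hint 0 h0 s hs) (hint 0 h0 t ht),
      intervalIntegral.integral_interval_sub_left (hint 0 h0 s hs).norm (hint 0 h0 t ht).norm,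
      one_mul]
    exact intervalIntegral.norm_integral_le_abs_integral_norm
  have hC : IsCompact (x '' Set.Icc 0 T) := isCompact_Icc.image_of_continuousOn
    (hicc ▸ hxac.continuousOn)
  obtain ⟨K, hK⟩ := hlip.exists_lipschitzOnWith hC (by
    rintro _ ⟨t, ht, rfl⟩
    exact hdom t ht)
  refine AbsolutelyContinuousOnInterval.of_dist_le (K := K) hxac ?_
  rw [hicc]
  intro s hs t ht
  exact hK.dist_le_mul _ ⟨s, hs, rfl⟩ _ ⟨t, ht, rfl⟩

/-- The chain rule of a conservative field along absolutely continuous curves on `[0, T]`. -/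
theorem IsConservativeField.ae_hasDerivAt {d : ℕ} {Φ : Euc d → EReal}
    {D : Euc d → Set (Euc d)} (hD : IsConservativeField D Φ) {T : ℝ} (hT : 0 < T)
    {x u : ℝ → Euc d} (hu : IntervalIntegrable u volume 0 T)
    (hx : ∀ t ∈ Set.Icc (0:ℝ) T, x t = x 0 + ∫ s in (0:ℝ)..t, u s)
    (hdom : ∀ t ∈ Set.Icc (0:ℝ) T, (D (x t)).Nonempty) :
    ∀ᵐ t ∂volume, t ∈ Set.Ioo (0:ℝ) T →
      ∀ v ∈ D (x t), HasDerivAt (fun s => (Φ (x s)).toReal) (⟪v, u t⟫ : ℝ) t := by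
  have hmem : ∀ s ∈ Set.Icc (0:ℝ) 1, T * s ∈ Set.Icc 0 T := fun s hs =>
    ⟨mul_nonneg hT.le hs.1, mul_le_of_le_one_right hT.le hs.2⟩
  have key := hD.2.2 (fun s => x (T * s)) (fun s => T • u (T * s))
    (by
      have h := (hu.comp_mul_left (c := T)).smul T
      rwa [zero_div, div_self hT.ne'] at h)
    (fun s hs => by
      rw [intervalIntegral.integral_smul, intervalIntegral.smul_integral_comp_mul_left]
      simpa using hx _ (hmem s hs))
    (fun s hs => hdom _ (hmem s hs))
  have hmap : ∀ᵐ s ∂(Measure.map (fun t => T⁻¹ * t) volume), s ∈ Set.Ioo (0:ℝ) 1 →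
      ∀ v ∈ D (x (T * s)), HasDerivAt (fun r => (Φ (x (T * r))).toReal)
        (⟪v, T • u (T * s)⟫ : ℝ) s := by
    rw [Real.map_volume_mul_left (inv_ne_zero hT.ne')]
    exact Measure.ae_smul_measure key _
  filter_upwards [ae_of_ae_map (by fun_prop) hmap] with t ht hmt v hv
  have hTt : T * (T⁻¹ * t) = t := mul_inv_cancel_left₀ hT.ne' t
  simp only [hTt] at ht
  have hd := ht ⟨mul_pos (inv_pos.2 hT) hmt.1, by
    rw [inv_mul_lt_iff₀ hT, mul_one]; exact hmt.2⟩ v hv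
  have hc := hd.scomp t ((hasDerivAt_id t).const_mul T⁻¹)
  simp only [Function.comp_def, mul_inv_cancel_left₀ hT.ne', inner_smul_right, mul_one,
    smul_eq_mul, inv_mul_cancel_left₀ hT.ne'] at hc
  exact hc

/-- Cauchy–Schwarz for the integral of a real function against the constant one. -/
theorem integral_le_sqrt_mul_sqrt_integral_sq {f : ℝ → ℝ} {T : ℝ} (hT : 0 < T)
    (hf : IntervalIntegrable f volume 0 T)
    (hf2 : IntervalIntegrable (fun t => f t ^ 2) volume 0 T) :
    ∫ t in (0:ℝ)..T, f t ≤ Real.sqrt T * Real.sqrt (∫ t in (0:ℝ)..T, f t ^ 2) := by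
  rw [← Real.sqrt_mul hT.le]
  refine Real.le_sqrt_of_sq_le ?_
  set I := ∫ t in (0:ℝ)..T, f t
  have hpos : 0 ≤ ∫ t in (0:ℝ)..T, (f t - I / T) ^ 2 :=
    intervalIntegral.integral_nonneg hT.le fun t _ => sq_nonneg _
  have hexp : ∫ t in (0:ℝ)..T, (f t - I / T) ^ 2
      = (∫ t in (0:ℝ)..T, f t ^ 2) - 2 * (I / T) * I + T * (I / T) ^ 2 := by
    have : ∀ t, (f t - I / T) ^ 2 = f t ^ 2 - 2 * (I / T) * f t + (I / T) ^ 2 := fun t => by ring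
    simp_rw [this]
    rw [intervalIntegral.integral_add (hf2.sub (hf.const_mul _)) intervalIntegrable_const,
      intervalIntegral.integral_sub hf2 (hf.const_mul _), intervalIntegral.integral_const_mul,
      intervalIntegral.integral_const]
    simp [I]
  rw [hexp] at hpos
  have hmul := mul_nonneg hT.le hpos
  field_simp at hmul
  nlinarith

/-- along a trajectory of `−D`, the energy identity
`∫₀ᵀ ‖u‖² = Φ(x(0)) − Φ(x(T))` holds, and the length is bounded by
`√T·√(Φ(x(0)) − inf Φ)`. -/
theorem stmt6 {d : ℕ} (Φ : Euc d → EReal)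
    (hproper : ProperFn Φ) (hlip : LocLipOnDom Φ)
    (hbdd : ∃ c : ℝ, ∀ y : Euc d, (c : EReal) ≤ Φ y)
    (D : Euc d → Set (Euc d)) (hD : IsConservativeField D Φ)
    (T : ℝ) (hT : 0 < T)
    (x u : ℝ → Euc d)
    (hu : IntervalIntegrable u volume 0 T)
    (hx : ∀ t ∈ Set.Icc (0:ℝ) T, x t = x 0 + ∫ s in (0:ℝ)..t, u s)
    (hdom : ∀ t ∈ Set.Icc (0:ℝ) T, (D (x t)).Nonempty)
    (hflow : ∀ᵐ t ∂volume, t ∈ Set.Icc (0:ℝ) T → -u t ∈ D (x t)) :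
    (∫ t in (0:ℝ)..T, ‖u t‖ ^ 2) = (Φ (x 0)).toReal - (Φ (x T)).toReal ∧
    (∫ t in (0:ℝ)..T, ‖u t‖) ≤
      Real.sqrt T * Real.sqrt ((Φ (x 0) - ⨅ y : Euc d, Φ y).toReal) := by
  have hdomΦ : ∀ t ∈ Set.Icc (0:ℝ) T, Φ (x t) ≠ ⊤ := fun t ht => hD.2.1 _ (hdom t ht)
  have hac := hlip.absolutelyContinuousOnInterval_comp hT.le hu hx hdomΦ
  have hderiv : ∀ᵐ t ∂volume, t ∈ Set.uIoc (0:ℝ) T →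
      deriv (fun s => (Φ (x s)).toReal) t = -‖u t‖ ^ 2 := by
    filter_upwards [hD.ae_hasDerivAt hT hu hx hdom, hflow,
      Measure.ae_ne volume T] with t hd hf hne ht
    rw [Set.uIoc_of_le hT.le] at ht
    rw [(hd ⟨ht.1, lt_of_le_of_ne ht.2 hne⟩ _ (hf ⟨ht.1.le, ht.2⟩)).deriv, inner_neg_left,
      real_inner_self_eq_norm_sq]
  have henergy : (∫ t in (0:ℝ)..T, ‖u t‖ ^ 2) = (Φ (x 0)).toReal - (Φ (x T)).toReal := by
    have h := hac.integral_deriv_eq_sub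
    rw [intervalIntegral.integral_congr_ae hderiv, intervalIntegral.integral_neg] at h
    linarith
  have hsq : IntervalIntegrable (fun t => ‖u t‖ ^ 2) volume 0 T := by
    have h := hac.intervalIntegrable_deriv.neg
    refine h.congr_ae ?_
    rw [Filter.EventuallyEq, ae_restrict_iff' measurableSet_uIoc]
    filter_upwards [hderiv] with t ht hmt
    simp [ht hmt]
  refine ⟨henergy, (integral_le_sqrt_mul_sqrt_integral_sq hT hu.norm hsq).trans ?_⟩
  refine mul_le_mul_of_nonneg_left (Real.sqrt_le_sqrt ?_) (Real.sqrt_nonneg T)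
  obtain ⟨c, hc⟩ := hbdd
  have hinf_bot : (⨅ y : Euc d, Φ y) ≠ ⊥ :=
    ((EReal.bot_lt_coe c).trans_le (le_iInf hc)).ne'
  have h0 := hdomΦ 0 ⟨le_rfl, hT.le⟩
  have hinf_top : (⨅ y : Euc d, Φ y) ≠ ⊤ := ((iInf_le Φ (x 0)).trans_lt h0.lt_top).ne
  rw [henergy, EReal.toReal_sub h0 (hproper.2 _) hinf_top hinf_bot]
  exact sub_le_sub_left (EReal.toReal_le_toReal (iInf_le Φ (x T)) hinf_bot
    (hdomΦ T ⟨hT.le, le_rfl⟩)) _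
end
end

section
/- Let Φ : ℝ^d → ℝ ∪ {+∞} be proper, bounded below, and ρ-weakly convex for some ρ ≥ 0. Let x : [0,∞) → ℝ^d be absolutely continuous with locally integrable derivative u such that for almost every t > 0, u(t) ∈ −∂Φ(x(t)), where ∂Φ(x) := {v : ∀ y, Φ(y) ≥ Φ(x) + ⟨v, y − x⟩ − ρ‖y − x‖²}. Then for every ε > 0 there exists T ≥ 0 such that ‖u(t)‖ ≤ ε for almost every t ≥ T. -/
open scoped RealInnerProductSpace
open MeasureTheory

noncomputable section

/-- Convexity via the epigraph. -/
def ConvexFn {d : ℕ} (Φ : Euc d → EReal) : Prop :=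
  Convex ℝ {p : Euc d × ℝ | Φ p.1 ≤ (p.2 : EReal)}

/-- Subdifferential of a `ρ`-weakly convex extended-real-valued function:
`∂Φ(x) = {v : ∀ y, Φ(y) ≥ Φ(x) + ⟨v, y − x⟩ − ρ‖y − x‖²}`. -/
def WSubdiffE {d : ℕ} (Φ : Euc d → EReal) (ρ : ℝ) (x : Euc d) : Set (Euc d) :=
  {v : Euc d | ∀ y : Euc d,
    Φ x + (((⟪v, y - x⟫ : ℝ) - ρ * ‖y - x‖ ^ 2 : ℝ) : EReal) ≤ Φ y}

open Set Filter Topology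

/-- A finite sum of absolutely continuous real functions is absolutely continuous. -/
theorem absolutelyContinuousOnInterval_finset_sum {ι : Type*} (s : Finset ι) {f : ι → ℝ → ℝ}
    {a b : ℝ} (hf : ∀ i ∈ s, AbsolutelyContinuousOnInterval (f i) a b) :
    AbsolutelyContinuousOnInterval (fun t => ∑ i ∈ s, f i t) a b := by
  classical
  induction s using Finset.induction_on with
  | empty =>
    simpa using (LipschitzWith.const (0 : ℝ)).lipschitzOnWith.absolutelyContinuousOnInterval
  | insert i s hi ih =>
    simp only [Finset.sum_insert hi]
    exact (hf i (Finset.mem_insert_self i s)).fun_add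
      (ih fun j hj => hf j (Finset.mem_insert_of_mem hj))

theorem AbsolutelyContinuousOnInterval.congr_of_eqOn {f g : ℝ → ℝ} {a b : ℝ}
    (hf : AbsolutelyContinuousOnInterval f a b) (h : EqOn g f (uIcc a b)) :
    AbsolutelyContinuousOnInterval g a b := by
  rw [absolutelyContinuousOnInterval_iff] at hf ⊢
  intro ε hε
  obtain ⟨δ, hδ, H⟩ := hf ε hε
  refine ⟨δ, hδ, fun E hE hlen => ?_⟩
  refine lt_of_eq_of_lt (Finset.sum_congr rfl fun i hi => ?_) (H E hE hlen)
  rw [h (hE.1 i hi).1, h (hE.1 i hi).2]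

theorem AbsolutelyContinuousOnInterval.le_of_ae_deriv_nonpos {f : ℝ → ℝ} {a b : ℝ} (hab : a ≤ b)
    (hf : AbsolutelyContinuousOnInterval f a b)
    (h : ∀ᵐ t, t ∈ Icc a b → deriv f t ≤ 0) : f b ≤ f a := by
  have h0 := hf.integral_deriv_eq_sub
  have h1 : ∫ t in a..b, deriv f t ≤ ∫ _ in a..b, (0 : ℝ) := by
    refine intervalIntegral.integral_mono_ae_restrict hab hf.intervalIntegrable_deriv
      (by simp) ?_
    exact (ae_restrict_iff' measurableSet_Icc).2 h
  simp only [intervalIntegral.integral_zero] at h1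
  linarith

/-- `x` is a primitive of the locally integrable function `u` on `[0, ∞)`. -/
structure IsPrimitive {d : ℕ} (x u : ℝ → Euc d) : Prop where
  intervalIntegrable : ∀ T ≥ (0 : ℝ), IntervalIntegrable u volume 0 T
  eq_integral : ∀ t ≥ (0 : ℝ), x t = x 0 + ∫ s in (0 : ℝ)..t, u s

namespace IsPrimitive

variable {d : ℕ} {x u : ℝ → Euc d}

theorem intervalIntegrable_of_nonneg (hx : IsPrimitive x u) {a b : ℝ} (ha : 0 ≤ a) (hb : 0 ≤ b) :
    IntervalIntegrable u volume a b :=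
  (hx.intervalIntegrable a ha).symm.trans (hx.intervalIntegrable b hb)

theorem sub_eq_integral (hx : IsPrimitive x u) {a b : ℝ} (ha : 0 ≤ a) (hb : 0 ≤ b) :
    x b - x a = ∫ s in a..b, u s := by
  rw [hx.eq_integral a ha, hx.eq_integral b hb, add_sub_add_left_eq_sub,
    intervalIntegral.integral_interval_sub_left (hx.intervalIntegrable b hb)
      (hx.intervalIntegrable a ha)]

theorem comp_add_right (hx : IsPrimitive x u) {h : ℝ} (hh : 0 ≤ h) :
    IsPrimitive (fun t => x (t + h)) (fun t => u (t + h)) where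
  intervalIntegrable T hT := by
    have := (hx.intervalIntegrable_of_nonneg hh (add_nonneg hT hh)).comp_add_right h
    simpa using this
  eq_integral t ht := by
    have := hx.sub_eq_integral (a := 0 + h) (b := t + h) (by simpa) (by positivity)
    rw [intervalIntegral.integral_comp_add_right (fun s => u s) h, ← this]
    simp

theorem ae_hasDerivAt (hx : IsPrimitive x u) : ∀ᵐ t, 0 < t → HasDerivAt x (u t) t := by
  have h : ∀ᵐ t, ∀ n : ℕ, t ∈ uIcc (0 : ℝ) n → ∀ c ∈ uIcc (0 : ℝ) n,
      HasDerivAt (fun y => ∫ s in c..y, u s) (u t) t :=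
    ae_all_iff.2 fun n =>
      (hx.intervalIntegrable n (Nat.cast_nonneg n)).ae_hasDerivAt_integral
  filter_upwards [h] with t ht htpos
  obtain ⟨n, hn⟩ := exists_nat_ge t
  have h1 := ht n (by rw [uIcc_of_le (Nat.cast_nonneg n)]; exact ⟨htpos.le, hn⟩) 0 (by simp)
  refine (h1.const_add (x 0)).congr_of_eventuallyEq ?_
  filter_upwards [Ioi_mem_nhds htpos] with s hs
  exact hx.eq_integral s (le_of_lt hs)

theorem absolutelyContinuousOnInterval_apply (hx : IsPrimitive x u) (i : Fin d) {a b : ℝ}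
    (ha : 0 ≤ a) (hb : 0 ≤ b) : AbsolutelyContinuousOnInterval (fun t => x t i) a b := by
  let L : Euc d →L[ℝ] ℝ := EuclideanSpace.proj i
  have hu : IntervalIntegrable (fun t => L (u t)) volume 0 (max a b) :=
    let h := hx.intervalIntegrable (max a b) (le_max_of_le_left ha)
    ⟨L.integrable_comp h.1, L.integrable_comp h.2⟩
  have h1 := hu.absolutelyContinuousOnInterval_intervalIntegral (c := 0) (by simp)
  have h2 : AbsolutelyContinuousOnInterval (fun _ : ℝ => x 0 i) 0 (max a b) :=
    (LipschitzWith.const (x 0 i)).lipschitzOnWith.absolutelyContinuousOnInterval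
  have hm : 0 ≤ max a b := le_max_of_le_left ha
  have hsub : uIcc a b ⊆ uIcc 0 (max a b) := by
    rw [uIcc_of_le hm]
    exact fun t ht => ⟨(le_min ha hb).trans ht.1, ht.2⟩
  refine ((h2.fun_add h1).mono hsub).congr_of_eqOn fun t ht => ?_
  have ht0 : 0 ≤ t := (le_min ha hb).trans ht.1
  have h3 := L.intervalIntegral_comp_comm (hx.intervalIntegrable t ht0)
  simp only [h3]
  change x t i = L (x 0) + L (∫ s in (0 : ℝ)..t, u s)
  rw [← map_add, ← hx.eq_integral t ht0]
  rfl

theorem absolutelyContinuousOnInterval_norm_sq_sub {y v : ℝ → Euc d} (hx : IsPrimitive x u)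
    (hy : IsPrimitive y v) {a b : ℝ} (ha : 0 ≤ a) (hb : 0 ≤ b) :
    AbsolutelyContinuousOnInterval (fun t => ‖y t - x t‖ ^ 2) a b := by
  have h (i : Fin d) : AbsolutelyContinuousOnInterval (fun t => y t i - x t i) a b :=
    (hy.absolutelyContinuousOnInterval_apply i ha hb).fun_sub
      (hx.absolutelyContinuousOnInterval_apply i ha hb)
  have h2 := absolutelyContinuousOnInterval_finset_sum Finset.univ
    (fun i _ => (h i).fun_mul (h i))
  refine h2.congr_of_eqOn fun t _ => ?_
  simp [EuclideanSpace.norm_sq_eq, ← sq]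

/-- Grönwall's inequality for the distance of two trajectories of a one-sided Lipschitz flow. -/
theorem norm_sub_le_exp_mul {y v : ℝ → Euc d} (hx : IsPrimitive x u) (hy : IsPrimitive y v)
    {ρ : ℝ}
    (h : ∀ᵐ t, 0 < t → ⟪y t - x t, v t - u t⟫ ≤ 2 * ρ * ‖y t - x t‖ ^ 2)
    {a b : ℝ} (ha : 0 < a) (hab : a ≤ b) :
    ‖y b - x b‖ ≤ Real.exp (2 * ρ * (b - a)) * ‖y a - x a‖ := by
  have hb : 0 < b := ha.trans_le hab
  have hexp : AbsolutelyContinuousOnInterval (fun t => Real.exp (-4 * ρ * t)) a b := by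
    apply ContDiffOn.absolutelyContinuousOnInterval
    fun_prop
  have hac := hexp.fun_mul (hx.absolutelyContinuousOnInterval_norm_sq_sub hy ha.le hb.le)
  have key := hac.le_of_ae_deriv_nonpos hab ?_
  · have h1 : ‖y b - x b‖ ^ 2 ≤ (Real.exp (2 * ρ * (b - a)) * ‖y a - x a‖) ^ 2 := by
      have h2 := mul_le_mul_of_nonneg_left key (Real.exp_pos (4 * ρ * b)).le
      rw [← mul_assoc, ← mul_assoc, ← Real.exp_add, ← Real.exp_add] at h2
      rw [mul_pow, ← Real.exp_nat_mul]
      have e1 : 4 * ρ * b + -4 * ρ * b = 0 := by ring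
      have e2 : 4 * ρ * b + -4 * ρ * a = (2 : ℕ) * (2 * ρ * (b - a)) := by push_cast; ring
      rwa [e1, e2, Real.exp_zero, one_mul] at h2
    exact le_of_sq_le_sq h1 (by positivity)
  · filter_upwards [h, hx.ae_hasDerivAt, hy.ae_hasDerivAt] with t ht hxt hyt htm
    have ht0 : 0 < t := ha.trans_le htm.1
    have hd := ((hyt ht0).sub (hxt ht0)).norm_sq
    have he : HasDerivAt (fun t => Real.exp (-4 * ρ * t))
        (Real.exp (-4 * ρ * t) * (-4 * ρ)) t := by
      simpa using ((hasDerivAt_id t).const_mul (-4 * ρ)).exp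
    have := (he.mul hd).deriv
    have h3 : deriv (fun t => Real.exp (-4 * ρ * t) * ‖y t - x t‖ ^ 2) t
      = Real.exp (-4 * ρ * t) * (-4 * ρ) * ‖y t - x t‖ ^ 2 +
        Real.exp (-4 * ρ * t) * (2 * ⟪y t - x t, v t - u t⟫) := this
    rw [h3]
    have h4 := mul_le_mul_of_nonneg_left (ht ht0) (Real.exp_pos (-4 * ρ * t)).le
    linarith

theorem norm_sub_le_of_ae_norm_le (hx : IsPrimitive x u) {a b M : ℝ} (ha : 0 ≤ a)
    (hM : ∀ᵐ t, t ∈ Icc a b → ‖u t‖ ≤ M) {s t : ℝ} (hs : s ∈ Icc a b) (ht : t ∈ Icc a b) :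
    ‖x t - x s‖ ≤ M * |t - s| := by
  rw [hx.sub_eq_integral (ha.trans hs.1) (ha.trans ht.1)]
  apply intervalIntegral.norm_integral_le_of_norm_le_const_ae
  filter_upwards [hM] with r hr hrm
  exact hr (uIcc_subset_Icc hs ht (uIoc_subset_uIcc hrm))

end IsPrimitive

/-- A trajectory with velocity `u` along which the energy `φ` satisfies, at almost all pairs of
times, the subgradient inequality of a `ρ`-weakly convex function. The set `G` consists of
times where this inequality holds and `x` is differentiable. -/
structure IsSubgradientTrajectory {d : ℕ} (x u : ℝ → Euc d) (φ : ℝ → ℝ) (ρ : ℝ)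
    (G : Set ℝ) : Prop extends IsPrimitive x u where
  nonneg : 0 ≤ ρ
  ae_mem : ∀ᵐ t, 0 < t → t ∈ G
  pos : ∀ t ∈ G, 0 < t
  hasDerivAt : ∀ t ∈ G, HasDerivAt x (u t) t
  subgradient_le : ∀ t ∈ G, ∀ s ∈ G,
    φ t - ⟪u t, x s - x t⟫ - ρ * ‖x s - x t‖ ^ 2 ≤ φ s

namespace IsSubgradientTrajectory

variable {d : ℕ} {x u : ℝ → Euc d} {φ : ℝ → ℝ} {ρ : ℝ} {G : Set ℝ}

theorem norm_velocity_le (H : IsSubgradientTrajectory x u φ ρ G) {s t : ℝ} (hs : s ∈ G)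
    (ht : t ∈ G) (hst : s ≤ t) : ‖u t‖ ≤ Real.exp (2 * ρ * (t - s)) * ‖u s‖ := by
  have hinc (h : ℝ) (hh : 0 < h) :
      ‖x (t + h) - x t‖ ≤ Real.exp (2 * ρ * (t - s)) * ‖x (s + h) - x s‖ := by
    refine H.toIsPrimitive.norm_sub_le_exp_mul (H.toIsPrimitive.comp_add_right hh.le) ?_
      (H.pos s hs) hst
    have hshift : ∀ᵐ r, 0 < r + h → r + h ∈ G :=
      (measurePreserving_add_right volume h).quasiMeasurePreserving.ae H.ae_mem
    filter_upwards [H.ae_mem, hshift] with r hr hrh hr0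
    have h1 := H.subgradient_le r (hr hr0) (r + h) (hrh (by positivity))
    have h2 := H.subgradient_le (r + h) (hrh (by positivity)) r (hr hr0)
    rw [norm_sub_rev (x r), ← neg_sub (x (r + h)) (x r), inner_neg_right] at h2
    rw [inner_sub_right, real_inner_comm _ (x (r + h) - x r),
      real_inner_comm _ (x (r + h) - x r)]
    linarith
  have hlt := ((H.hasDerivAt t ht).tendsto_slope_zero_right).norm
  have hls := ((H.hasDerivAt s hs).tendsto_slope_zero_right).norm.const_mul
    (Real.exp (2 * ρ * (t - s)))
  refine le_of_tendsto_of_tendsto hlt hls ?_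
  filter_upwards [self_mem_nhdsWithin] with h hh
  rw [norm_smul, norm_smul, mul_left_comm]
  exact mul_le_mul_of_nonneg_left (hinc h hh) (norm_nonneg _)

theorem dense_good (H : IsSubgradientTrajectory x u φ ρ G) : Dense {t : ℝ | 0 < t → t ∈ G} :=
  Measure.dense_of_ae H.ae_mem

/-- The energy identity along a subgradient trajectory. -/
theorem integral_norm_sq_eq (H : IsSubgradientTrajectory x u φ ρ G) {a b : ℝ} (ha : a ∈ G)
    (hb : b ∈ G) (hab : a ≤ b) :
    IntervalIntegrable (fun t => ‖u t‖ ^ 2) volume a b ∧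
      ∫ t in a..b, ‖u t‖ ^ 2 = φ a - φ b := by
  have ha0 := H.pos a ha
  have hρ := H.nonneg
  set M := Real.exp (2 * ρ * (b - a)) * ‖u a‖ with hMdef
  have hM0 : 0 ≤ M := by positivity
  have hM : ∀ t ∈ G ∩ Icc a b, ‖u t‖ ≤ M := fun t ht => by
    refine (H.norm_velocity_le ha ht.1 ht.2.1).trans ?_
    have := ht.2.2
    rw [hMdef]
    gcongr
  have hMae : ∀ᵐ t, t ∈ Icc a b → ‖u t‖ ≤ M := by
    filter_upwards [H.ae_mem] with t ht htm
    exact hM t ⟨ht (ha0.trans_le htm.1), htm⟩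
  have hxl {s t : ℝ} (hs : s ∈ Icc a b) (ht : t ∈ Icc a b) : ‖x t - x s‖ ≤ M * |t - s| :=
    H.toIsPrimitive.norm_sub_le_of_ae_norm_le ha0.le hMae hs ht
  set K := M * M + ρ * (M * (M * (b - a))) with hK
  have hK0 : 0 ≤ K := by have := sub_nonneg.2 hab; positivity
  have hone : ∀ s ∈ G ∩ Icc a b, ∀ t ∈ G ∩ Icc a b, φ t - φ s ≤ K * |t - s| := by
    intro s hs t ht
    have h1 := H.subgradient_le t ht.1 s hs.1
    have h2 := hxl ht.2 hs.2
    rw [abs_sub_comm] at h2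
    have h3 : ⟪u t, x s - x t⟫ ≤ M * (M * |t - s|) :=
      (real_inner_le_norm _ _).trans (mul_le_mul (hM t ht) h2 (norm_nonneg _) hM0)
    have h4 : |t - s| ≤ b - a := abs_sub_le_of_le_of_le ht.2.1 ht.2.2 hs.2.1 hs.2.2
    have h5 : ‖x s - x t‖ ^ 2 ≤ (M * |t - s|) * (M * (b - a)) := by
      rw [sq]
      exact mul_le_mul h2 (h2.trans (by gcongr)) (norm_nonneg _) (by positivity)
    have h6 := mul_le_mul_of_nonneg_left h5 hρ
    rw [hK]
    linarith
  have hlip : LipschitzOnWith ⟨K, hK0⟩ φ (G ∩ Icc a b) := by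
    refine LipschitzOnWith.of_dist_le_mul fun t ht s hs => ?_
    rw [Real.dist_eq, Real.dist_eq, abs_le]
    have h1 := hone s hs t ht
    have h2 := hone t ht s hs
    rw [abs_sub_comm] at h2
    exact ⟨(neg_le_neg h2).trans_eq (neg_sub _ _), h1⟩
  obtain ⟨ψ, hψ, hφψ⟩ := hlip.extend_real
  have hψac : AbsolutelyContinuousOnInterval ψ a b :=
    hψ.lipschitzOnWith.absolutelyContinuousOnInterval
  have hderiv : ∀ᵐ t, t ∈ Ioo a b → deriv ψ t = -‖u t‖ ^ 2 := by
    filter_upwards [H.ae_mem, hψ.ae_differentiableAt_real] with t htG htd htm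
    replace htG := htG (ha0.trans htm.1)
    let q : ℝ → ℝ := fun s => ψ s + ⟪u t, x s - x t⟫ + ρ * ‖x s - x t‖ ^ 2
    have hxd := (H.hasDerivAt t htG).sub_const (x t)
    have hqd : HasDerivAt q (deriv ψ t + ⟪u t, u t⟫ + ρ * (2 * ⟪x t - x t, u t⟫)) t := by
      refine (htd.hasDerivAt.add ?_).add (hxd.norm_sq.const_mul ρ)
      simpa using (hasDerivAt_const t (u t)).inner ℝ hxd
    have hxc : ContinuousOn x (Icc a b) := by
      refine (LipschitzOnWith.of_dist_le_mul (K := ⟨M, hM0⟩) fun r hr s hs => ?_).continuousOn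
      rw [dist_eq_norm, Real.dist_eq]
      exact hxl hs hr
    have hmin : IsLocalMin q t := by
      filter_upwards [Ioo_mem_nhds htm.1 htm.2] with s hs
      by_contra! hlt
      have hxs : ContinuousAt x s := hxc.continuousAt (Icc_mem_nhds hs.1 hs.2)
      have hqs : ContinuousAt q s := by
        have := hψ.continuous.continuousAt (x := s)
        fun_prop
      have hev := (hqs.eventually (Iio_mem_nhds hlt)).and (Ioo_mem_nhds hs.1 hs.2)
      obtain ⟨r, hrG, hr1, hr2⟩ :=
        ((mem_closure_iff_frequently.1 (H.dense_good s)).and_eventually hev).exists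
      have hr3 : r ∈ G := hrG (ha0.trans hr2.1)
      have h1 := H.subgradient_le t htG r hr3
      rw [hφψ ⟨htG, Ioo_subset_Icc_self htm⟩, hφψ ⟨hr3, Ioo_subset_Icc_self hr2⟩] at h1
      have h2 : ψ r + ⟪u t, x r - x t⟫ + ρ * ‖x r - x t‖ ^ 2 < q t := hr1
      simp only [q, sub_self, inner_zero_right, norm_zero] at h2
      norm_num at h2
      linarith
    have h0 := hmin.hasDerivAt_eq_zero hqd
    rw [real_inner_self_eq_norm_sq, sub_self, inner_zero_left] at h0
    linarith
  have hae : ∀ᵐ t, t ∈ uIoc a b → -deriv ψ t = ‖u t‖ ^ 2 := by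
    have hne : ∀ᵐ t : ℝ, t ≠ b := by simp [ae_iff, measure_singleton]
    filter_upwards [hderiv, hne] with t ht htb htm
    rw [uIoc_of_le hab] at htm
    rw [ht ⟨htm.1, lt_of_le_of_ne htm.2 htb⟩, neg_neg]
  refine ⟨hψac.intervalIntegrable_deriv.neg.congr_ae
    ((ae_restrict_iff' measurableSet_uIoc).2 hae), ?_⟩
  rw [← intervalIntegral.integral_congr_ae hae, intervalIntegral.integral_neg,
    hψac.integral_deriv_eq_sub, hφψ ⟨ha, le_refl a, hab⟩, hφψ ⟨hb, hab, le_refl b⟩]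
  ring

theorem exists_mem_gt (H : IsSubgradientTrajectory x u φ ρ G) {r : ℝ} (hr : 0 ≤ r) :
    ∃ t ∈ G, r < t := by
  obtain ⟨t, ht, htr⟩ := H.dense_good.exists_mem_open (isOpen_Ioi (a := r)) nonempty_Ioi
  exact ⟨t, ht (hr.trans_lt htr), htr⟩

/-- If the energy is bounded below, the squared speed has finite integral up to infinity. -/
theorem integrableOn_norm_sq (H : IsSubgradientTrajectory x u φ ρ G) {c : ℝ}
    (hc : ∀ t ∈ G, c ≤ φ t) {a : ℝ} (ha : a ∈ G) :
    IntegrableOn (fun t => ‖u t‖ ^ 2) (Ioi a) := by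
  have hex (n : ℕ) : ∃ t ∈ G, a + n < t :=
    H.exists_mem_gt (by have := H.pos a ha; positivity)
  choose b hbG hb using hex
  have hab (n : ℕ) : a ≤ b n := by
    have : (0 : ℝ) ≤ n := Nat.cast_nonneg n
    linarith [hb n]
  have htend : Tendsto b atTop atTop :=
    tendsto_atTop_mono (fun n => (hb n).le)
      (tendsto_atTop_add_const_left _ a tendsto_natCast_atTop_atTop)
  refine integrableOn_Ioi_of_intervalIntegral_norm_bounded (φ a - c) a (fun n => ?_) htend
    (Eventually.of_forall fun n => ?_)
  · exact (intervalIntegrable_iff_integrableOn_Ioc_of_le (hab n)).1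
      (H.integral_norm_sq_eq ha (hbG n) (hab n)).1
  · simp only [norm_pow, norm_norm]
    rw [(H.integral_norm_sq_eq ha (hbG n) (hab n)).2]
    linarith [hc _ (hbG n)]

/-- If the energy is bounded below, the speed is eventually small. -/
theorem exists_forall_norm_velocity_le (H : IsSubgradientTrajectory x u φ ρ G) {c : ℝ}
    (hc : ∀ t ∈ G, c ≤ φ t) {ε : ℝ} (hε : 0 < ε) :
    ∃ T ≥ (0 : ℝ), ∀ t ∈ G, T ≤ t → ‖u t‖ ≤ ε := by
  obtain ⟨a, ha, ha0⟩ := H.exists_mem_gt le_rfl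
  have hint := H.integrableOn_norm_sq hc ha
  have hii {p q : ℝ} (hp : a ≤ p) (hpq : p ≤ q) :
      IntervalIntegrable (fun t => ‖u t‖ ^ 2) volume p q :=
    (intervalIntegrable_iff_integrableOn_Ioc_of_le hpq).2
      (hint.mono_set fun t ht => hp.trans_lt ht.1)
  have hlim := intervalIntegral_tendsto_integral_Ioi a hint tendsto_id
  have hlim' := intervalIntegral_tendsto_integral_Ioi a hint
    (tendsto_atTop_add_const_right atTop (-1) tendsto_id)
  have hdiff := hlim.sub hlim'
  rw [sub_self] at hdiff
  set C := Real.exp (4 * ρ) with hC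
  have hsmall : ∀ᶠ t in atTop, (∫ s in a..id t, ‖u s‖ ^ 2) - (∫ s in a..id t + -1, ‖u s‖ ^ 2)
      < C⁻¹ * ε ^ 2 :=
    hdiff.eventually (Iio_mem_nhds (by positivity))
  obtain ⟨T, hT⟩ := eventually_atTop.1 hsmall
  refine ⟨max T (a + 1), le_max_of_le_right (by linarith), fun t ht hTt => ?_⟩
  have hat : a + 1 ≤ t := (le_max_right _ _).trans hTt
  have h1 := hT t ((le_max_left _ _).trans hTt)
  simp only [id] at h1
  rw [intervalIntegral.integral_interval_sub_left (hii le_rfl (by linarith))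
    (hii le_rfl (by linarith))] at h1
  have h2 : ∫ _ in (t + -1)..t, C⁻¹ * ‖u t‖ ^ 2 ≤ ∫ s in (t + -1)..t, ‖u s‖ ^ 2 := by
    refine intervalIntegral.integral_mono_ae_restrict (by linarith) (by simp)
      (hii (by linarith) (by linarith)) ((ae_restrict_iff' measurableSet_Icc).2 ?_)
    filter_upwards [H.ae_mem] with s hs hsm
    have hv := H.norm_velocity_le (hs (by linarith [hsm.1])) ht hsm.2
    have hv' : ‖u t‖ ≤ Real.exp (2 * ρ) * ‖u s‖ := by
      refine hv.trans ?_
      have : 2 * ρ * (t - s) ≤ 2 * ρ := by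
        have := H.nonneg
        nlinarith [hsm.1]
      gcongr
    have hsq : ‖u t‖ ^ 2 ≤ C * ‖u s‖ ^ 2 := by
      have h := pow_le_pow_left₀ (norm_nonneg _) hv' 2
      rw [mul_pow, ← Real.exp_nat_mul] at h
      have he : C = Real.exp ((2 : ℕ) * (2 * ρ)) := by rw [hC]; congr 1; push_cast; ring
      rwa [he]
    exact (inv_mul_le_iff₀ (Real.exp_pos _)).2 hsq
  rw [intervalIntegral.integral_const, show t - (t + -1) = 1 by ring, one_smul] at h2
  have h3 : C⁻¹ * ‖u t‖ ^ 2 < C⁻¹ * ε ^ 2 := h2.trans_lt h1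
  have h4 : ‖u t‖ ^ 2 < ε ^ 2 := lt_of_mul_lt_mul_left h3 (by positivity)
  exact (lt_of_pow_lt_pow_left₀ 2 hε.le h4).le

end IsSubgradientTrajectory

theorem WSubdiffE.ne_top {d : ℕ} {Φ : Euc d → EReal} {ρ : ℝ} {x v : Euc d}
    (hΦ : ProperFn Φ) (hv : v ∈ WSubdiffE Φ ρ x) : Φ x ≠ ⊤ := by
  obtain ⟨y, hy⟩ := hΦ.1
  intro h
  have := hv y
  rw [h, EReal.top_add_coe, top_le_iff] at this
  exact hy this

theorem WSubdiffE.toReal_le {d : ℕ} {Φ : Euc d → EReal} {ρ : ℝ} {x y v : Euc d}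
    (hΦ : ProperFn Φ) (hv : v ∈ WSubdiffE Φ ρ x) (hy : Φ y ≠ ⊤) :
    (Φ x).toReal + (⟪v, y - x⟫ - ρ * ‖y - x‖ ^ 2) ≤ (Φ y).toReal := by
  have h := hv y
  rw [← EReal.coe_toReal (WSubdiffE.ne_top hΦ hv) (hΦ.2 x), ← EReal.coe_toReal hy (hΦ.2 y),
    ← EReal.coe_add] at h
  exact EReal.coe_le_coe_iff.1 h

/-- along a subgradient trajectory of a proper, lower-bounded,
`ρ`-weakly convex function, the speed eventually becomes (a.e.) smaller than any
prescribed `ε > 0`. -/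
theorem stmt13 {d : ℕ} (Φ : Euc d → EReal) (ρ : ℝ) (hρ : 0 ≤ ρ)
    (hproper : ProperFn Φ)
    (hbdd : ∃ c : ℝ, ∀ x : Euc d, (c : EReal) ≤ Φ x)
    (hwc : ConvexFn (fun x : Euc d => Φ x + ((ρ * ‖x‖ ^ 2 : ℝ) : EReal)))
    (x u : ℝ → Euc d)
    (hint : ∀ T ≥ (0:ℝ), IntervalIntegrable u volume 0 T)
    (hac : ∀ t ≥ (0:ℝ), x t = x 0 + ∫ s in (0:ℝ)..t, u s)
    (hflow : ∀ᵐ t ∂volume, 0 < t → -u t ∈ WSubdiffE Φ ρ (x t)) :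
    ∀ ε > (0:ℝ), ∃ T ≥ (0:ℝ), ∀ᵐ t ∂volume, T ≤ t → ‖u t‖ ≤ ε := by
  have hx : IsPrimitive x u := ⟨hint, hac⟩
  obtain ⟨c, hc⟩ := hbdd
  let G : Set ℝ := {t | 0 < t ∧ -u t ∈ WSubdiffE Φ ρ (x t) ∧ HasDerivAt x (u t) t}
  have hG : ∀ᵐ t, 0 < t → t ∈ G := by
    filter_upwards [hflow, hx.ae_hasDerivAt] with t h1 h2 ht
    exact ⟨ht, h1 ht, h2 ht⟩
  have H : IsSubgradientTrajectory x u (fun t => (Φ (x t)).toReal) ρ G :=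
    { hx with
      nonneg := hρ
      ae_mem := hG
      pos := fun t ht => ht.1
      hasDerivAt := fun t ht => ht.2.2
      subgradient_le := fun t ht s hs => by
        have := WSubdiffE.toReal_le hproper ht.2.1 (WSubdiffE.ne_top hproper hs.2.1)
        rw [inner_neg_left] at this
        linarith }
  have hcG : ∀ t ∈ G, c ≤ (Φ (x t)).toReal := fun t ht => by
    have h := hc (x t)
    rw [← EReal.coe_toReal (WSubdiffE.ne_top hproper ht.2.1) (hproper.2 _)] at h
    exact EReal.coe_le_coe_iff.1 h
  intro ε hε
  obtain ⟨T, hT0, hT⟩ := H.exists_forall_norm_velocity_le hcG hε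
  refine ⟨T, hT0, ?_⟩
  have hne : ∀ᵐ t : ℝ, t ≠ 0 := by simp [ae_iff, measure_singleton]
  filter_upwards [hG, hne] with t htG ht0 hTt
  exact hT t (htG (lt_of_le_of_ne (hT0.trans hTt) ht0.symm)) hTt
end
end
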